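/- Let (λ(i))_{i≥1} be a strictly positive sequence with Λ := ∑_{i=1}^∞ λ(i)² < ∞, ∑_{i=1}^∞ |log λ(i)|² λ(i)² < ∞ and σ > 0, and fix ε ∈ (0,1). For each d ∈ ℕ let ζ = ζ(ε,d) be the largest positive real number such that ∑_{k ∈ ℕ^d : λ_k < ζ} λ_k² ≤ ε²·Λ^d, and set θ(ε,d) := −(log ζ + d·M)/(σ·√d). Then lim_{d→∞} θ(ε,d) = q(ε)/σ, where q(ε) is the unique real number satisfying 1 − Φ(q/σ) = ε² and Φ is the standard normal distribution function. -/

import Mathlib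

open scoped BigOperators
open Real MeasureTheory Filter

/-- Λ := ∑ λ(i)². -/
noncomputable def bigLambda (lam : ℕ → ℝ) : ℝ := ∑' i, lam i ^ 2

/-- tensor eigenvalue λ_k = ∏ λ(k_l). -/
noncomputable def tensorEig (lam : ℕ → ℝ) {d : ℕ} (k : Fin d → ℕ) : ℝ := ∏ l, lam (k l)

/-- relative approximation complexity n(ε,d). -/
noncomputable def complexity (lam : ℕ → ℝ) (ε : ℝ) (d : ℕ) : ℕ :=
  sInf { n : ℕ | ∃ K : Finset (Fin d → ℕ), K.card = n ∧
    (∑' k : {k : Fin d → ℕ // k ∉ K}, tensorEig lam k.1 ^ 2) ≤ ε ^ 2 * bigLambda lam ^ d }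

/-- M := −∑ log λ(i) · λ(i)²/Λ. -/
noncomputable def meanM (lam : ℕ → ℝ) : ℝ :=
  -(∑' i, Real.log (lam i) * lam i ^ 2) / bigLambda lam

/-- σ² := ∑ (log λ(i))² · λ(i)²/Λ − M². -/
noncomputable def sigma2 (lam : ℕ → ℝ) : ℝ :=
  (∑' i, Real.log (lam i) ^ 2 * lam i ^ 2) / bigLambda lam - meanM lam ^ 2

/-- σ. -/
noncomputable def sigma (lam : ℕ → ℝ) : ℝ := Real.sqrt (sigma2 lam)

/-- standard normal distribution function Φ. -/
noncomputable def stdNormalCDF (x : ℝ) : ℝ :=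
  ∫ t in Set.Iic x, Real.exp (-t ^ 2 / 2) / Real.sqrt (2 * Real.pi)

open ProbabilityTheory

lemma tsum_measureReal_singleton {α : Type*} [Countable α] [MeasurableSpace α]
    [MeasurableSingletonClass α] (μ : Measure α) [IsFiniteMeasure μ] (s : Set α) :
    ∑' k : s, μ.real {k.1} = μ.real s := by
  rw [measureReal_def, ← μ.tsum_indicator_apply_singleton s s.to_countable.measurableSet,
    ← tsum_subtype s (fun x => μ {x}), ENNReal.tsum_toReal_eq fun _ => measure_ne_top _ _]
  rfl

lemma bigLambda_pos {lam : ℕ → ℝ} (hpos : ∀ i, 0 < lam i)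
    (hΛ : Summable fun i => lam i ^ 2) : 0 < bigLambda lam :=
  hΛ.tsum_pos (fun _ => sq_nonneg _) 0 (pow_pos (hpos 0) 2)

/-- The probability measure on `ℕ` giving mass `λ(i)² / Λ` to `i`. -/
noncomputable def weightMeasure (lam : ℕ → ℝ) : Measure ℕ :=
  Measure.sum fun i => ENNReal.ofReal (lam i ^ 2 / bigLambda lam) • Measure.dirac i

lemma toReal_ofReal_weight (lam : ℕ → ℝ) (i : ℕ) :
    (ENNReal.ofReal (lam i ^ 2 / bigLambda lam)).toReal = lam i ^ 2 / bigLambda lam :=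
  ENNReal.toReal_ofReal (div_nonneg (sq_nonneg _) (tsum_nonneg fun _ => sq_nonneg _))

lemma isProbabilityMeasure_weightMeasure {lam : ℕ → ℝ} (hpos : ∀ i, 0 < lam i)
    (hΛ : Summable fun i => lam i ^ 2) : IsProbabilityMeasure (weightMeasure lam) := by
  have h0 := bigLambda_pos hpos hΛ
  have := hΛ.hasSum.div_const (bigLambda lam)
  rw [← bigLambda, div_self h0.ne'] at this
  exact this.isProbabilityMeasure_sum_dirac fun _ => div_nonneg (sq_nonneg _) h0.le

lemma weightMeasure_real_singleton (lam : ℕ → ℝ) (i : ℕ) :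
    (weightMeasure lam).real {i} = lam i ^ 2 / bigLambda lam := by
  rw [measureReal_def, weightMeasure, Measure.sum_smul_dirac_singleton, toReal_ofReal_weight]

lemma integral_weightMeasure (lam : ℕ → ℝ) (f : ℕ → ℝ) :
    ∫ i, f i ∂weightMeasure lam = (∑' i, f i * lam i ^ 2) / bigLambda lam := by
  rw [weightMeasure, integral_sum_dirac (by simp), ← tsum_div_const]
  congr with i
  rw [toReal_ofReal_weight, smul_eq_mul]
  ring

lemma memLp_log_weightMeasure {lam : ℕ → ℝ}
    (hsum : Summable fun i => |Real.log (lam i)| ^ 2 * lam i ^ 2) :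
    MemLp (fun i => -Real.log (lam i)) 2 (weightMeasure lam) := by
  rw [memLp_two_iff_integrable_sq (measurable_of_countable _).aestronglyMeasurable, weightMeasure,
    integrable_sum_dirac_iff (by simp)]
  refine (hsum.div_const (bigLambda lam)).congr fun i => ?_
  rw [toReal_ofReal_weight]
  simp only [norm_pow, norm_neg, Real.norm_eq_abs]
  ring

lemma integral_neg_log_weightMeasure (lam : ℕ → ℝ) :
    ∫ i, -Real.log (lam i) ∂weightMeasure lam = meanM lam := by
  rw [integral_weightMeasure, meanM]
  simp [tsum_neg]

lemma variance_neg_log_weightMeasure {lam : ℕ → ℝ} (hpos : ∀ i, 0 < lam i)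
    (hΛ : Summable fun i => lam i ^ 2)
    (hsum : Summable fun i => |Real.log (lam i)| ^ 2 * lam i ^ 2) :
    Var[fun i => -Real.log (lam i); weightMeasure lam] = sigma2 lam := by
  have := isProbabilityMeasure_weightMeasure hpos hΛ
  rw [variance_eq_sub (memLp_log_weightMeasure hsum), integral_neg_log_weightMeasure, sigma2]
  simp [integral_weightMeasure]

lemma stdNormalCDF_eq_measureReal (x : ℝ) :
    stdNormalCDF x = (gaussianReal 0 1).real (Set.Iic x) := by
  rw [measureReal_def, gaussianReal_apply_eq_integral _ one_ne_zero,
    ENNReal.toReal_ofReal (integral_nonneg fun _ => gaussianPDFReal_nonneg _ _ _), stdNormalCDF]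
  refine integral_congr_ae (ae_of_all _ fun t => ?_)
  simp [gaussianPDFReal]
  ring

lemma strictMono_stdNormalCDF : StrictMono stdNormalCDF := by
  intro a b hab
  rw [stdNormalCDF_eq_measureReal, stdNormalCDF_eq_measureReal, ← Set.Iic_union_Ioc_eq_Iic hab.le,
    measureReal_union (Set.Iic_disjoint_Ioc le_rfl) measurableSet_Ioc, lt_add_iff_pos_right,
    measureReal_def]
  refine ENNReal.toReal_pos (fun h => ?_) (measure_ne_top _ _)
  have := gaussianReal_absolutelyContinuous' 0 one_ne_zero h
  simp only [Real.volume_Ioc, ENNReal.ofReal_eq_zero] at this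
  linarith

lemma tsum_tensorEig_sq {lam : ℕ → ℝ} (hpos : ∀ i, 0 < lam i)
    (hΛ : Summable fun i => lam i ^ 2) (d : ℕ) (z : ℝ) :
    ∑' k : {k : Fin d → ℕ // tensorEig lam k < z}, tensorEig lam k.1 ^ 2
      = (Measure.pi fun _ : Fin d => weightMeasure lam).real {k | tensorEig lam k < z} *
        bigLambda lam ^ d := by
  have := isProbabilityMeasure_weightMeasure hpos hΛ
  rw [← tsum_measureReal_singleton, ← tsum_mul_right]
  refine tsum_congr fun k => ?_
  rw [measureReal_def, Measure.pi_singleton, ENNReal.toReal_prod]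
  simp only [← measureReal_def, weightMeasure_real_singleton, Finset.prod_div_distrib,
    Finset.prod_const, Finset.card_univ, Fintype.card_fin, Finset.prod_pow, tensorEig]
  rw [div_mul_cancel₀ _ (pow_pos (bigLambda_pos hpos hΛ) d).ne']

/-- Restricting an i.i.d. sequence to its first `d` terms gives the product measure. -/
lemma map_infinitePi_fin {α : Type*} [MeasurableSpace α] (μ : Measure α)
    [IsProbabilityMeasure μ] (d : ℕ) :
    (Measure.infinitePi fun _ : ℕ => μ).map (fun ω (l : Fin d) => ω l)
      = Measure.pi fun _ : Fin d => μ := by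
  rw [Measure.map_infinitePi_infinitePi_of_inj (P := fun _ : ℕ => μ) Fin.val_injective,
    Measure.infinitePi_eq_pi]

/-- The mass of `{λ_k < z}` for a Gaussian-scaled threshold `z` converges to a normal tail. -/
lemma tendsto_pi_weightMeasure_real {lam : ℕ → ℝ} (hpos : ∀ i, 0 < lam i)
    (hΛ : Summable fun i => lam i ^ 2)
    (hsum : Summable fun i => |Real.log (lam i)| ^ 2 * lam i ^ 2)
    (hσ : 0 < sigma lam) (t : ℝ) :
    Tendsto (fun d : ℕ => (Measure.pi fun _ : Fin d => weightMeasure lam).real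
        {k | tensorEig lam k < Real.exp (-(d * meanM lam + sigma lam * √d * t))})
      atTop (nhds (1 - stdNormalCDF t)) := by
  have := isProbabilityMeasure_weightMeasure hpos hΛ
  set μ := weightMeasure lam with hμ
  set P : Measure (ℕ → ℕ) := Measure.infinitePi fun _ : ℕ => μ
  have hlaw (i : ℕ) : P.map (fun ω => ω i) = μ := Measure.infinitePi_map_eval (fun _ => μ) i
  set X : ℕ → (ℕ → ℕ) → ℝ := fun i ω => -Real.log (lam (ω i))
  have hXmeas (i : ℕ) : Measurable (X i) :=
    (measurable_of_countable fun n : ℕ => -Real.log (lam n)).comp (measurable_pi_apply i)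
  have hXd (i : ℕ) : IdentDistrib (X i) (fun n : ℕ => -Real.log (lam n)) P μ := by
    refine ⟨(hXmeas i).aemeasurable, by fun_prop, ?_⟩
    rw [← hlaw i, Measure.map_map (by fun_prop) (by fun_prop)]
    rfl
  have hmean : P[X 0] = meanM lam := by
    rw [(hXd 0).integral_eq, hμ, integral_neg_log_weightMeasure]
  have hs2 : 0 < sigma2 lam := Real.sqrt_pos.1 hσ
  have hvar : Var[X 0; P] = sigma2 lam := by
    rw [(hXd 0).variance_eq, hμ, variance_neg_log_weightMeasure hpos hΛ hsum]
  have hY : HasLaw (fun x : ℝ => sigma lam * x) (gaussianReal 0 Var[X 0; P].toNNReal)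
      (gaussianReal 0 1) := by
    refine ⟨by fun_prop, ?_⟩
    rw [gaussianReal_map_const_mul, hvar]
    congr 1
    · simp
    · ext
      simp [sigma, Real.sq_sqrt hs2.le, hs2.le]
  have clt := (tendstoInDistribution_inv_sqrt_mul_sum_sub hY
    ((hXd 0).memLp_iff.2 (memLp_log_weightMeasure hsum))
    (iIndepFun_infinitePi (P := fun _ : ℕ => μ)
      (X := fun _ n => -Real.log (lam n)) (fun _ => measurable_of_countable _))
    (fun i => (hXd i).trans (hXd 0).symm)).tendsto
  have hpre : (fun x : ℝ => sigma lam * x) ⁻¹' Set.Ioi (sigma lam * t) = Set.Ioi t := by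
    ext x
    simp only [Set.mem_preimage, Set.mem_Ioi, mul_lt_mul_iff_right₀ hσ]
  have hpre' : (fun x : ℝ => sigma lam * x) ⁻¹' {sigma lam * t} = {t} := by
    ext x
    simp [hσ.ne']
  have key := ProbabilityMeasure.tendsto_measure_of_null_frontier_of_tendsto'
    clt (E := Set.Ioi (sigma lam * t)) (by
      have := nullSingletonClass_gaussianReal (μ := 0) (v := 1) one_ne_zero
      simp only [ProbabilityMeasure.coe_mk, frontier_Ioi]
      rw [Measure.map_apply (by fun_prop) (by simp), hpre']
      exact measure_singleton t)
  simp only [ProbabilityMeasure.coe_mk] at key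
  rw [Measure.map_apply (by fun_prop) measurableSet_Ioi, hpre] at key
  have key' := (ENNReal.tendsto_toReal (measure_ne_top _ _)).comp key
  have htail : ((gaussianReal 0 1) (Set.Ioi t)).toReal = 1 - stdNormalCDF t := by
    rw [stdNormalCDF_eq_measureReal, ← measureReal_def, ← Set.compl_Iic,
      probReal_compl_eq_one_sub measurableSet_Iic]
  rw [htail] at key'
  refine key'.congr' ?_
  filter_upwards [eventually_gt_atTop 0] with d hd
  have hd' : 0 < √(d : ℝ) := by positivity
  simp only [Function.comp_apply]
  rw [measureReal_def, ← map_infinitePi_fin μ d, Measure.map_apply (by fun_prop) measurableSet_Ioi,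
    Measure.map_apply (by fun_prop) (Set.to_countable _).measurableSet]
  congr 2
  ext ω
  simp only [Set.mem_preimage, Set.mem_Ioi, Set.mem_ofPred_eq]
  have hprod : 0 < tensorEig lam fun l : Fin d => ω l := Finset.prod_pos fun l _ => hpos _
  have hS : ∑ k ∈ Finset.range d, X k ω = -Real.log (tensorEig lam fun l : Fin d => ω l) := by
    rw [tensorEig, Real.log_prod fun l _ => (hpos _).ne', ← Finset.sum_neg_distrib,
      Finset.sum_range]
  rw [← Real.log_lt_iff_lt_exp hprod, hS, hmean, inv_mul_eq_div, lt_div_iff₀ hd']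
  constructor <;> intro h <;> linarith

/-- Convergence of the quantiles: `θ(ε,d) → q(ε)/σ` as `d → ∞`. -/
theorem theta_tendsto_quantile
    (lam : ℕ → ℝ) (hpos : ∀ i, 0 < lam i)
    (hΛ : Summable fun i => lam i ^ 2)
    (hsum : Summable fun i => |Real.log (lam i)| ^ 2 * lam i ^ 2)
    (hσ : 0 < sigma lam)
    (ε : ℝ) (hε : ε ∈ Set.Ioo (0 : ℝ) 1)
    (ζ : ℕ → ℝ)
    (hζ : ∀ d : ℕ, IsGreatest {z : ℝ | 0 < z ∧
      (∑' k : {k : Fin d → ℕ // tensorEig lam k < z}, tensorEig lam k.1 ^ 2)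
        ≤ ε ^ 2 * bigLambda lam ^ d} (ζ d))
    (q : ℝ) (hq : 1 - stdNormalCDF (q / sigma lam) = ε ^ 2) :
    Tendsto
      (fun d : ℕ => -(Real.log (ζ d) + d * meanM lam) / (sigma lam * Real.sqrt d))
      atTop (nhds (q / sigma lam)) := by
  have := isProbabilityMeasure_weightMeasure hpos hΛ
  set mass : ℕ → ℝ → ℝ := fun d z =>
    (Measure.pi fun _ : Fin d => weightMeasure lam).real {k | tensorEig lam k < z}
  have mass_mono (d : ℕ) : Monotone (mass d) := fun a b hab =>
    measureReal_mono fun k hk => lt_of_lt_of_le hk hab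
  have hζ' (d : ℕ) : IsGreatest {z | 0 < z ∧ mass d z ≤ ε ^ 2} (ζ d) := by
    simpa only [tsum_tensorEig_sq hpos hΛ,
      mul_le_mul_iff_left₀ (pow_pos (bigLambda_pos hpos hΛ) d)] using hζ d
  have lt_theta_iff {d : ℕ} (hd : 0 < d) (t : ℝ) :
      t < -(Real.log (ζ d) + d * meanM lam) / (sigma lam * √d) ↔
        ζ d < Real.exp (-(d * meanM lam + sigma lam * √d * t)) := by
    have : 0 < sigma lam * √(d : ℝ) := by positivity
    rw [← Real.log_lt_iff_lt_exp (hζ' d).1.1, lt_div_iff₀ this]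
    constructor <;> intro h <;> linarith
  refine tendsto_order.2 ⟨fun t ht => ?_, fun t ht => ?_⟩
  · have hlt : ε ^ 2 < 1 - stdNormalCDF t := by linarith [strictMono_stdNormalCDF ht]
    filter_upwards [eventually_gt_atTop 0,
      (tendsto_pi_weightMeasure_real hpos hΛ hsum hσ t).eventually_const_lt hlt] with d hd hlt'
    rw [lt_theta_iff hd]
    by_contra! hle
    exact ((mass_mono d hle).trans (hζ' d).1.2).not_gt hlt'
  · obtain ⟨s, hs, hst⟩ := exists_between ht
    have hlt : 1 - stdNormalCDF s < ε ^ 2 := by linarith [strictMono_stdNormalCDF hs]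
    filter_upwards [eventually_gt_atTop 0,
      (tendsto_pi_weightMeasure_real hpos hΛ hsum hσ s).eventually_lt_const hlt] with d hd hlt'
    refine lt_of_le_of_lt (not_lt.1 fun h => ?_) hst
    exact ((hζ' d).2 ⟨Real.exp_pos _, hlt'.le⟩).not_gt ((lt_theta_iff hd s).1 h)
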